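/- Suppose condition (B_p) holds for some p > 1, and conditions (Q_∞) and (M_C) hold. Then there exists ε > 0 such that sup_x E[|Y_{n+1} − Y_n|^{1+ε} | Y_n = x] < ∞; and, as x → ∞, E[Y_{n+1} − Y_n | Y_n = x] = (1/π(0)) Σ_{i∈S} d_i π(i) + o(1). -/

import Mathlib

open MeasureTheory Filter Topology Asymptotics
open scoped ENNReal NNReal

/-- A time-homogeneous Markov chain on a measurable state space `E`, encoded via the family
`P z` of laws (on trajectory space) of the chain started at `z`.  The field `markov` is the
time-homogeneous Markov property: conditionally on the event `{ω n = w}` intersected with any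
event `B` depending only on the first `n+1` coordinates, the shifted trajectory has law `P w`. -/
structure MChain (E : Type*) [MeasurableSpace E] where
  P : E → MeasureTheory.Measure (ℕ → E)
  isProb : ∀ z, MeasureTheory.IsProbabilityMeasure (P z)
  init : ∀ z, P z {ω | ω 0 = z} = 1
  markov : ∀ (z : E) (n : ℕ) (w : E) (A B : Set (ℕ → E)), MeasurableSet A →
    (∀ ω ω' : ℕ → E, (∀ k, k ≤ n → ω k = ω' k) → ω ∈ B → ω' ∈ B) →
    P z (B ∩ {ω | ω n = w} ∩ {ω | (fun k => ω (n + k)) ∈ A})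
      = P z (B ∩ {ω | ω n = w}) * P w A

namespace MChain

variable {E : Type*} [MeasurableSpace E]

/-- Irreducibility: every state can be reached from every state with positive probability. -/
def Irreducible (X : MChain E) : Prop := ∀ z w : E, ∃ n : ℕ, X.P z {ω | ω n = w} ≠ 0

/-- Recurrence: from every state, the chain returns to it almost surely. -/
def Recurrent (X : MChain E) : Prop := ∀ z : E, X.P z {ω | ∃ n, 1 ≤ n ∧ ω n = z} = 1

def Transient (X : MChain E) : Prop := ¬ X.Recurrent

/-- The first return time to `z` (with junk value `0`, via `sInf ∅ = 0`, if there is no return). -/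
noncomputable def returnTime (z : E) (ω : ℕ → E) : ℕ := sInf {n | 1 ≤ n ∧ ω n = z}

/-- Positive recurrence: recurrent, with finite mean return times. -/
def PositiveRecurrent (X : MChain E) : Prop :=
  X.Recurrent ∧ ∀ z : E, (∫⁻ ω, (returnTime z ω : ℝ≥0∞) ∂(X.P z)) ≠ ⊤

def NullRecurrent (X : MChain E) : Prop := X.Recurrent ∧ ¬ X.PositiveRecurrent

end MChain

section HalfStrip

variable {S : Type*} [Fintype S] [DecidableEq S] [Nonempty S]
  [MeasurableSpace S] [MeasurableSingletonClass S]

/-- `qhat X x i j` is the probability that the `S`-coordinate moves from `i` to `j` when the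
`ℕ`-coordinate is at `x`; this is `q_x(i,j) = Σ_y p(x,i,y,j)` of the paper. -/
noncomputable def qhat (X : MChain (ℕ × S)) (x : ℕ) (i j : S) : ℝ :=
  (X.P (x, i) {ω | (ω 1).2 = j}).toReal

/-- `stepMoment X k x i = μ_k(x,i) = E[(X_{n+1}-X_n)^k | X_n = x, η_n = i]`. -/
noncomputable def stepMoment (X : MChain (ℕ × S)) (k : ℕ) (x : ℕ) (i : S) : ℝ :=
  ∫ ω, (((ω 1).1 : ℝ) - (x : ℝ)) ^ k ∂(X.P (x, i))

/-- Condition (B_p): uniformly bounded conditional `p`-th moments of the jumps of the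
`ℕ`-coordinate (by the Markov property, the conditional moment given `F_n` is a function of
the current state only). -/
def CondB (X : MChain (ℕ × S)) (p : ℝ) : Prop :=
  ∃ C : ℝ≥0∞, C ≠ ⊤ ∧ ∀ (x : ℕ) (i : S),
    (∫⁻ ω, ENNReal.ofReal (|((ω 1).1 : ℝ) - (x : ℝ)| ^ p) ∂(X.P (x, i))) ≤ C

def IsStochasticMatrix (Q : S → S → ℝ) : Prop :=
  (∀ i j, 0 ≤ Q i j) ∧ ∀ i, (∑ j, Q i j) = 1

def IsIrreducibleMatrix (Q : S → S → ℝ) : Prop :=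
  ∀ i j, ∃ n : ℕ, 0 < ((Matrix.of Q) ^ n) i j

/-- Aperiodicity (for a finite irreducible stochastic matrix, eventual positivity of the
diagonal entries of the powers is equivalent to aperiodicity). -/
def IsAperiodicMatrix (Q : S → S → ℝ) : Prop :=
  ∀ i, ∃ N : ℕ, ∀ n, N ≤ n → 0 < ((Matrix.of Q) ^ n) i i

/-- `pst` is a (strictly positive) stationary distribution for `Q`. -/
def IsStationaryDist (Q : S → S → ℝ) (pst : S → ℝ) : Prop :=
  (∀ i, 0 < pst i) ∧ (∑ i, pst i) = 1 ∧ ∀ j, (∑ i, pst i * Q i j) = pst j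

/-- Condition (Q_∞): the transition matrix of the `S`-coordinate converges as `x → ∞` to an
irreducible stochastic matrix `Q`. -/
def CondQ (X : MChain (ℕ × S)) (Q : S → S → ℝ) : Prop :=
  (∀ i j, Tendsto (fun x : ℕ => qhat X x i j) atTop (nhds (Q i j))) ∧
    IsStochasticMatrix Q ∧ IsIrreducibleMatrix Q

/-- Condition (Q_∞^+): as (Q_∞), with a power-law rate of convergence. -/
def CondQplus (X : MChain (ℕ × S)) (Q : S → S → ℝ) : Prop :=
  (∃ δ₀ : ℝ, 0 < δ₀ ∧ ∀ i j,
      (fun x : ℕ => qhat X x i j - Q i j) =O[atTop] fun x : ℕ => (x : ℝ) ^ (-δ₀)) ∧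
    IsStochasticMatrix Q ∧ IsIrreducibleMatrix Q

/-- Condition (M_C): asymptotically constant drifts, `μ₁(x,i) = d_i + o(1)`. -/
def CondMC (X : MChain (ℕ × S)) (d : S → ℝ) : Prop :=
  ∀ i, Tendsto (fun x : ℕ => stepMoment X 1 x i) atTop (nhds (d i))

/-- Condition (M_L): Lamperti-type drifts, `μ₁(x,i) = c_i/x + o(1/x)`, `μ₂(x,i) = s_i² + o(1)`,
with at least one `s_i²` nonzero. -/
def CondML (X : MChain (ℕ × S)) (c s2 : S → ℝ) : Prop :=
  (∀ i, 0 ≤ s2 i) ∧ (∃ i, s2 i ≠ 0) ∧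
    (∀ i, Tendsto (fun x : ℕ => (x : ℝ) * stepMoment X 1 x i) atTop (nhds (c i))) ∧
    (∀ i, Tendsto (fun x : ℕ => stepMoment X 2 x i) atTop (nhds (s2 i)))

/-- Condition (M_L^+): Lamperti-type drifts with power-law error bounds. -/
def CondMLplus (X : MChain (ℕ × S)) (c s2 : S → ℝ) : Prop :=
  (∀ i, 0 ≤ s2 i) ∧ (∃ i, s2 i ≠ 0) ∧
    ∃ δ₁ : ℝ, 0 < δ₁ ∧ ∀ i,
      ((fun x : ℕ => stepMoment X 1 x i - c i / (x : ℝ)) =O[atTop]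
        fun x : ℕ => (x : ℝ) ^ (-1 - δ₁)) ∧
      ((fun x : ℕ => stepMoment X 2 x i - s2 i) =O[atTop] fun x : ℕ => (x : ℝ) ^ (-δ₁))

/-- Successive visit times `τ_0 < τ_1 < ⋯` of the `S`-coordinate to the distinguished state
`s0` (junk value, via `sInf ∅ = 0`, if there is no such visit). -/
noncomputable def tauSeq (s0 : S) (ω : ℕ → ℕ × S) : ℕ → ℕ
  | 0 => sInf {n | (ω n).2 = s0}
  | m + 1 => sInf {n | tauSeq s0 ω m < n ∧ (ω n).2 = s0}

/-- `τ`, the first positive time at which the `S`-coordinate visits `s0`. -/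
noncomputable def tauRet (s0 : S) (ω : ℕ → ℕ × S) : ℕ :=
  sInf {n | 1 ≤ n ∧ (ω n).2 = s0}

/-- `D_n`, the maximal displacement of the `ℕ`-coordinate during the `n`-th excursion. -/
noncomputable def Dexc (s0 : S) (n : ℕ) (ω : ℕ → ℕ × S) : ℕ :=
  Finset.sup (Finset.Icc (tauSeq s0 ω n) (tauSeq s0 ω (n + 1)))
    fun m => Nat.dist (ω m).1 (ω (tauSeq s0 ω n)).1

/-- `N(n) = max {k : τ_k ≤ n}`. -/
noncomputable def Ncount (s0 : S) (n : ℕ) (ω : ℕ → ℕ × S) : ℕ :=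
  sSup {k | tauSeq s0 ω k ≤ n}

end HalfStrip

/-- `Fdist a t` is the distribution function of the square root of a `Gamma(a,t)` random
variable: `F_{a,t}(x) = ∫_0^x 2 u^{2a-1} e^{-u²/t} / (t^a Γ(a)) du`. -/
noncomputable def Fdist (a t x : ℝ) : ℝ :=
  ∫ u in (0:ℝ)..x, 2 * u ^ (2 * a - 1) * Real.exp (-(u ^ 2) / t) / (t ^ a * Real.Gamma a)

variable {S : Type*} [Fintype S] [DecidableEq S] [Nonempty S]
  [MeasurableSpace S] [MeasurableSingletonClass S]

set_option linter.unusedSectionVars false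

namespace MChain

section Markov

variable {E : Type*} [MeasurableSpace E]

instance instIsProbabilityMeasureP (X : MChain E) (z : E) : IsProbabilityMeasure (X.P z) :=
  X.isProb z

theorem measurable_shift (n : ℕ) : Measurable (fun (ω : ℕ → E) (k : ℕ) => ω (n + k)) := by
  fun_prop

variable [Countable E] [MeasurableSingletonClass E]

/-- The set `B` of trajectories is determined by the coordinates `0, …, n`. -/
def DependsUpTo (n : ℕ) (B : Set (ℕ → E)) : Prop :=
  ∀ ω ω' : ℕ → E, (∀ k, k ≤ n → ω k = ω' k) → ω ∈ B → ω' ∈ B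

theorem DependsUpTo.measurableSet {n : ℕ} {B : Set (ℕ → E)} (h : DependsUpTo n B) :
    MeasurableSet B := by
  have hr : Measurable (fun (ω : ℕ → E) (k : Fin (n + 1)) => ω k) := by fun_prop
  have hB : B = (fun (ω : ℕ → E) (k : Fin (n + 1)) => ω k) ⁻¹'
      ((fun (ω : ℕ → E) (k : Fin (n + 1)) => ω k) '' B) := by
    refine Set.Subset.antisymm (Set.subset_preimage_image _ _) ?_
    rintro ω ⟨ω', hω', he⟩
    exact h ω' ω (fun k hk => congrFun he ⟨k, Nat.lt_succ_of_le hk⟩) hω'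
  rw [hB]
  exact hr (Set.to_countable _).measurableSet

theorem measurableSet_coord_eq (n : ℕ) (w : E) : MeasurableSet {ω : ℕ → E | ω n = w} :=
  (measurableSet_singleton w).preimage (measurable_pi_apply n)

theorem map_shift_restrict (X : MChain E) (z : E) (n : ℕ) (w : E) {B : Set (ℕ → E)}
    (hB : DependsUpTo n B) :
    ((X.P z).restrict (B ∩ {ω | ω n = w})).map (fun ω k => ω (n + k))
      = X.P z (B ∩ {ω | ω n = w}) • X.P w := by
  ext A hA
  rw [Measure.map_apply (measurable_shift n) hA, Measure.restrict_apply (measurable_shift n hA),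
    Set.inter_comm]
  exact X.markov z n w A B hA hB

theorem lintegral_shift (X : MChain E) (z : E) (n : ℕ) {B : Set (ℕ → E)}
    (hB : DependsUpTo n B) {G : (ℕ → E) → ℝ≥0∞} (hG : Measurable G) :
    ∫⁻ ω in B, G (fun k => ω (n + k)) ∂(X.P z)
      = ∫⁻ ω in B, (∫⁻ ω', G ω' ∂(X.P (ω n))) ∂(X.P z) := by
  have hBU : B = ⋃ w, B ∩ {ω | ω n = w} := by ext ω; simp
  have hm : ∀ w, MeasurableSet (B ∩ {ω | ω n = w}) := fun w =>
    hB.measurableSet.inter (measurableSet_coord_eq n w)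
  have hd : Pairwise (Function.onFun Disjoint fun w => B ∩ {ω | ω n = w}) := by
    intro w w' hw
    refine Set.disjoint_left.2 ?_
    rintro ω ⟨-, h1⟩ ⟨-, h2⟩
    exact hw (h1.symm.trans h2)
  rw [hBU, lintegral_iUnion hm hd, lintegral_iUnion hm hd]
  congr 1
  funext w
  rw [← lintegral_map hG (measurable_shift n), map_shift_restrict X z n w hB,
    lintegral_smul_measure,
    setLIntegral_congr_fun (g := fun _ => ∫⁻ ω', G ω' ∂(X.P w)) (hm w) ?_]
  · simp [mul_comm]
  · rintro ω ⟨-, h⟩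
    have h' : ω n = w := h
    simp only [h']

theorem integral_shift (X : MChain E) (z : E) (n : ℕ) {B : Set (ℕ → E)}
    (hB : DependsUpTo n B) {G : (ℕ → E) → ℝ} (hG : Measurable G)
    (hi : IntegrableOn (fun ω => G (fun k => ω (n + k))) B (X.P z))
    (hi' : IntegrableOn (fun ω => ∫ ω', G ω' ∂(X.P (ω n))) B (X.P z)) :
    ∫ ω in B, G (fun k => ω (n + k)) ∂(X.P z)
      = ∫ ω in B, (∫ ω', G ω' ∂(X.P (ω n))) ∂(X.P z) := by
  have hBU : B = ⋃ w, B ∩ {ω | ω n = w} := by ext ω; simp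
  have hm : ∀ w, MeasurableSet (B ∩ {ω | ω n = w}) := fun w =>
    hB.measurableSet.inter (measurableSet_coord_eq n w)
  have hd : Pairwise (Function.onFun Disjoint fun w => B ∩ {ω | ω n = w}) := by
    intro w w' hw
    refine Set.disjoint_left.2 ?_
    rintro ω ⟨-, h1⟩ ⟨-, h2⟩
    exact hw (h1.symm.trans h2)
  rw [hBU] at hi hi'
  rw [hBU, integral_iUnion hm hd hi, integral_iUnion hm hd hi']
  congr 1
  funext w
  rw [← integral_map (measurable_shift n).aemeasurable hG.aestronglyMeasurable,
    map_shift_restrict X z n w hB, integral_smul_measure,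
    setIntegral_congr_fun (g := fun _ => ∫ ω', G ω' ∂(X.P w)) (hm w) ?_]
  · simp [Measure.real]
  · rintro ω ⟨-, h⟩
    have h' : ω n = w := h
    simp only [h']

theorem ae_init (X : MChain E) (z : E) : ∀ᵐ ω ∂(X.P z), ω 0 = z := by
  have h := X.init z
  rwa [← prob_compl_eq_zero_iff (measurableSet_coord_eq 0 z)] at h

end Markov

end MChain

section Taboo

theorem abs_taboo_le {S : Type*} [DecidableEq S] {s0 : S} {φ : ℕ × S → ℝ} {K : ℝ} (hφ : ∀ w, |φ w| ≤ K) (w : ℕ × S) :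
    |if w.2 = s0 then 0 else φ w| ≤ K := by
  split_ifs
  · simpa using (abs_nonneg _).trans (hφ w)
  · exact hφ w

/-- The chain's `S`-coordinate avoids `s0` at the times `1, …, k`. -/
def avoidSet (s0 : S) (k : ℕ) : Set (ℕ → ℕ × S) :=
  {ω | ∀ m, 1 ≤ m → m ≤ k → (ω m).2 ≠ s0}

theorem dependsUpTo_avoidSet (s0 : S) (k : ℕ) : MChain.DependsUpTo k (avoidSet s0 k) := by
  intro ω ω' h hω m h1 hm
  rw [← h m hm]
  exact hω m h1 hm

theorem measurableSet_avoidSet (s0 : S) (k : ℕ) : MeasurableSet (avoidSet s0 k) :=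
  (dependsUpTo_avoidSet s0 k).measurableSet

theorem avoidSet_zero (s0 : S) : avoidSet s0 0 = Set.univ := by
  ext ω
  simp only [avoidSet, Set.mem_ofPred_eq, Set.mem_univ, iff_true]
  intro m h1 h2
  omega

theorem avoidSet_antitone (s0 : S) : Antitone (avoidSet s0) :=
  fun _ _ hkl _ hω m h1 hm => hω m h1 (hm.trans hkl)

theorem avoidSet_add (s0 : S) (k n : ℕ) :
    avoidSet s0 (k + n) = avoidSet s0 k ∩ {ω | (fun m => ω (k + m)) ∈ avoidSet s0 n} := by
  ext ω
  constructor
  · intro h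
    exact ⟨avoidSet_antitone s0 (Nat.le_add_right k n) h,
      fun m h1 hm => h (k + m) (by omega) (by omega)⟩
  · rintro ⟨h, h'⟩ m h1 hm
    rcases le_or_gt m k with hmk | hmk
    · exact h m h1 hmk
    · have := h' (m - k) (by omega) (by omega)
      simpa only [Nat.add_sub_cancel' hmk.le] using this

/-- One step of the chain on functions, killed when the `S`-coordinate enters `s0`. -/
noncomputable def tabooOp (X : MChain (ℕ × S)) (s0 : S) (φ : ℕ × S → ℝ) (z : ℕ × S) : ℝ :=
  ∫ ω, (if (ω 1).2 = s0 then 0 else φ (ω 1)) ∂(X.P z)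

/-- The action on functions of the matrix `Q` with the column `s0` deleted. -/
def tabooMat (Q : S → S → ℝ) (s0 : S) (γ : S → ℝ) (i : S) : ℝ :=
  ∑ j, if j = s0 then 0 else Q i j * γ j

theorem measurable_of_coord {β : Type*} [MeasurableSpace β] (f : ℕ × S → β) (n : ℕ) :
    Measurable fun ω : ℕ → ℕ × S => f (ω n) :=
  (measurable_of_countable f).comp (measurable_pi_apply n)

theorem integrable_of_coord (X : MChain (ℕ × S)) (z : ℕ × S) {φ : ℕ × S → ℝ} {K : ℝ}
    (hφ : ∀ w, |φ w| ≤ K) (n : ℕ) : Integrable (fun ω => φ (ω n)) (X.P z) :=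
  Integrable.of_bound (measurable_of_coord φ n).aestronglyMeasurable K
    (Eventually.of_forall fun ω => hφ (ω n))

theorem abs_tabooOp_le (X : MChain (ℕ × S)) (s0 : S) {φ : ℕ × S → ℝ} {K : ℝ}
    (hφ : ∀ w, |φ w| ≤ K) (z : ℕ × S) : |tabooOp X s0 φ z| ≤ K := by
  have h := norm_integral_le_of_norm_le_const (μ := X.P z)
    (f := fun ω => if (ω 1).2 = s0 then 0 else φ (ω 1)) (C := K)
    (Eventually.of_forall fun ω => abs_taboo_le hφ (ω 1))
  simpa [tabooOp] using h

theorem abs_tabooOp_iterate_le (X : MChain (ℕ × S)) (s0 : S) {φ : ℕ × S → ℝ} {K : ℝ}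
    (hφ : ∀ w, |φ w| ≤ K) (k : ℕ) (z : ℕ × S) : |(tabooOp X s0)^[k] φ z| ≤ K := by
  induction k generalizing z with
  | zero => exact hφ z
  | succ k ih =>
    rw [Function.iterate_succ_apply']
    exact abs_tabooOp_le X s0 ih z

theorem setIntegral_avoidSet (X : MChain (ℕ × S)) (s0 : S) {φ : ℕ × S → ℝ} {K : ℝ}
    (hφ : ∀ w, |φ w| ≤ K) (k : ℕ) (z : ℕ × S) :
    ∫ ω in avoidSet s0 k, φ (ω k) ∂(X.P z) = (tabooOp X s0)^[k] φ z := by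
  induction k generalizing φ with
  | zero =>
    have h : ∀ᵐ ω ∂(X.P z), φ (ω 0) = φ z := by
      filter_upwards [X.ae_init z] with ω hω
      rw [hω]
    rw [avoidSet_zero, Measure.restrict_univ, integral_congr_ae h]
    simp
  | succ k ih =>
    rw [Function.iterate_succ_apply, ← ih (abs_tabooOp_le X s0 hφ)]
    have hs := X.integral_shift z k (dependsUpTo_avoidSet s0 k)
      (G := fun ω => if (ω 1).2 = s0 then 0 else φ (ω 1))
      (measurable_of_coord (fun w => if w.2 = s0 then 0 else φ w) 1)
      (integrable_of_coord X z (abs_taboo_le hφ) (k + 1)).integrableOn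
      (integrable_of_coord X z (abs_tabooOp_le X s0 hφ) k).integrableOn
    refine Eq.trans ?_ hs
    rw [← integral_indicator (measurableSet_avoidSet s0 _),
      ← integral_indicator (measurableSet_avoidSet s0 _)]
    congr 1
    funext ω
    have hmem : ω ∈ avoidSet s0 (k + 1) ↔ ω ∈ avoidSet s0 k ∧ (ω (k + 1)).2 ≠ s0 := by
      rw [avoidSet_add]
      refine and_congr_right fun _ => ⟨fun h => h 1 le_rfl le_rfl, fun h m h1 hm => ?_⟩
      obtain rfl : m = 1 := le_antisymm hm h1
      exact h
    by_cases h1 : ω ∈ avoidSet s0 k <;> by_cases h2 : (ω (k + 1)).2 = s0 <;>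
      simp [Set.indicator, hmem, h1, h2]

theorem measureReal_avoidSet (X : MChain (ℕ × S)) (s0 : S) (k : ℕ) (z : ℕ × S) :
    (X.P z).real (avoidSet s0 k) = (tabooOp X s0)^[k] (fun _ => 1) z := by
  rw [← setIntegral_avoidSet X s0 (φ := fun _ => 1) (K := 1) (by simp) k z]
  simp

theorem tendsto_measure_coord_lt (X : MChain (ℕ × S)) {p : ℝ} (hp : 0 < p) (hB : CondB X p)
    (i : S) (M : ℕ) :
    Tendsto (fun x : ℕ => (X.P (x, i)).real {ω | (ω 1).1 < M}) atTop (𝓝 0) := by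
  obtain ⟨C, hC, hCB⟩ := hB
  have hle : ∀ᶠ x : ℕ in atTop, X.P (x, i) {ω | (ω 1).1 < M}
      ≤ C / ENNReal.ofReal (((x : ℝ) - M) ^ p) := by
    filter_upwards [eventually_gt_atTop M] with x hx
    have hxM : (0 : ℝ) < (x : ℝ) - M := by
      have : (M : ℝ) < x := by exact_mod_cast hx
      linarith
    have hpos : 0 < ((x : ℝ) - M) ^ p := Real.rpow_pos_of_pos hxM p
    calc X.P (x, i) {ω | (ω 1).1 < M}
        ≤ X.P (x, i) {ω | ENNReal.ofReal (((x : ℝ) - M) ^ p)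
            ≤ ENNReal.ofReal (|((ω 1).1 : ℝ) - (x : ℝ)| ^ p)} := by
          refine measure_mono fun ω hω => ?_
          refine ENNReal.ofReal_le_ofReal (Real.rpow_le_rpow hxM.le ?_ hp.le)
          have : ((ω 1).1 : ℝ) < M := by exact_mod_cast hω
          rw [abs_sub_comm]
          exact le_trans (by linarith) (le_abs_self _)
      _ ≤ _ := meas_ge_le_lintegral_div
          (measurable_of_coord
            (fun w => ENNReal.ofReal (|(w.1 : ℝ) - (x : ℝ)| ^ p)) 1).aemeasurable
          (by simpa using hpos) ENNReal.ofReal_ne_top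
      _ ≤ _ := ENNReal.div_le_div_right (hCB x i) _
  have hlim : Tendsto (fun x : ℕ => C / ENNReal.ofReal (((x : ℝ) - M) ^ p)) atTop (𝓝 0) := by
    rw [← ENNReal.div_top (a := C)]
    refine ENNReal.Tendsto.const_div ?_ (Or.inr hC)
    refine ENNReal.tendsto_ofReal_atTop.comp ((tendsto_rpow_atTop hp).comp ?_)
    exact tendsto_atTop_add_const_right _ _ tendsto_natCast_atTop_atTop
  have := tendsto_of_tendsto_of_tendsto_of_le_of_le' tendsto_const_nhds hlim
    (Eventually.of_forall fun _ => zero_le) hle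
  exact (ENNReal.tendsto_toReal ENNReal.zero_ne_top).comp this

theorem integral_snd_coord (X : MChain (ℕ × S)) (x : ℕ) (i : S) (f : S → ℝ) :
    ∫ ω, f (ω 1).2 ∂(X.P (x, i)) = ∑ j, qhat X x i j * f j := by
  have hm : Measurable fun ω : ℕ → ℕ × S => (ω 1).2 := measurable_of_coord Prod.snd 1
  have hf : AEStronglyMeasurable f ((X.P (x, i)).map fun ω => (ω 1).2) :=
    (measurable_of_countable f).aestronglyMeasurable
  have := Measure.isProbabilityMeasure_map (μ := X.P (x, i)) hm.aemeasurable
  rw [← integral_map hm.aemeasurable hf, integral_fintype (Integrable.of_finite)]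
  refine Finset.sum_congr rfl fun j _ => ?_
  rw [smul_eq_mul, Measure.real, Measure.map_apply hm (measurableSet_singleton j)]
  rfl

theorem tendsto_tabooOp (X : MChain (ℕ × S)) (s0 : S) {p : ℝ} (hp : 0 < p) (hB : CondB X p)
    {Q : S → S → ℝ} (hQ : ∀ i j, Tendsto (fun x : ℕ => qhat X x i j) atTop (𝓝 (Q i j)))
    {φ : ℕ × S → ℝ} {K : ℝ} (hφ : ∀ w, |φ w| ≤ K) {γ : S → ℝ}
    (hγ : ∀ j, Tendsto (fun x : ℕ => φ (x, j)) atTop (𝓝 (γ j))) (i : S) :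
    Tendsto (fun x : ℕ => tabooOp X s0 φ (x, i)) atTop (𝓝 (tabooMat Q s0 γ i)) := by
  have hγK : ∀ j, |γ j| ≤ K := fun j =>
    le_of_tendsto (hγ j).abs (Eventually.of_forall fun x => hφ (x, j))
  have hmain : Tendsto (fun x : ℕ => ∑ j, qhat X x i j * (if j = s0 then 0 else γ j)) atTop
      (𝓝 (tabooMat Q s0 γ i)) := by
    have : tabooMat Q s0 γ i = ∑ j, Q i j * (if j = s0 then 0 else γ j) :=
      Finset.sum_congr rfl fun j _ => by split_ifs <;> simp
    rw [this]
    exact tendsto_finsetSum _ fun j _ => (hQ i j).mul_const _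
  have herr : Tendsto (fun x : ℕ => tabooOp X s0 φ (x, i)
      - ∑ j, qhat X x i j * (if j = s0 then 0 else γ j)) atTop (𝓝 0) := by
    rw [Metric.tendsto_nhds]
    intro δ hδ
    have hev : ∀ᶠ y : ℕ in atTop, ∀ j, |φ (y, j) - γ j| < δ / 2 :=
      eventually_all.2 fun j => by
        simpa [Real.dist_eq] using Metric.tendsto_nhds.1 (hγ j) (δ / 2) (half_pos hδ)
    obtain ⟨M, hM⟩ := eventually_atTop.1 hev
    have hsmall := (tendsto_measure_coord_lt X hp hB i M).const_mul (2 * K)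
    rw [mul_zero] at hsmall
    filter_upwards [hsmall.eventually_lt_const (half_pos hδ)] with x hx
    have hms : MeasurableSet {ω : ℕ → ℕ × S | (ω 1).1 < M} :=
      measurableSet_lt (measurable_of_coord Prod.fst 1) measurable_const
    have hi1 : Integrable (fun ω : ℕ → ℕ × S => if (ω 1).2 = s0 then 0 else φ (ω 1))
        (X.P (x, i)) := integrable_of_coord X (x, i) (abs_taboo_le hφ) 1
    have hi2 : Integrable (fun ω : ℕ → ℕ × S => if (ω 1).2 = s0 then 0 else γ (ω 1).2)
        (X.P (x, i)) :=
      integrable_of_coord X (x, i) (abs_taboo_le (φ := fun w => γ w.2) fun w => hγK w.2) 1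
    rw [dist_zero_right, ← integral_snd_coord X x i (fun j => if j = s0 then 0 else γ j),
      tabooOp, ← integral_sub hi1 hi2]
    have hind : Integrable (fun ω : ℕ → ℕ × S =>
        δ / 2 + {ω : ℕ → ℕ × S | (ω 1).1 < M}.indicator (fun _ => 2 * K) ω) (X.P (x, i)) :=
      (integrable_const _).add ((integrable_const _).indicator hms)
    calc _ ≤ ∫ ω, (δ / 2 + {ω : ℕ → ℕ × S | (ω 1).1 < M}.indicator (fun _ => 2 * K) ω)
          ∂(X.P (x, i)) := by
          refine norm_integral_le_of_norm_le hind (Eventually.of_forall fun ω => ?_)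
          have hK : 0 ≤ K := (abs_nonneg _).trans (hφ (ω 1))
          by_cases hω : (ω 1).1 < M
          · have h1 := abs_taboo_le (s0 := s0) hφ (ω 1)
            have h2 := abs_taboo_le (s0 := s0) (φ := fun w => γ w.2) (fun w => hγK w.2) (ω 1)
            have h3 := abs_sub (if (ω 1).2 = s0 then 0 else φ (ω 1))
              (if (ω 1).2 = s0 then 0 else γ (ω 1).2)
            simp only [Set.indicator, Set.mem_ofPred_eq, hω, if_true, Real.norm_eq_abs]
            linarith
          · have h1 := hM (ω 1).1 (not_lt.1 hω) (ω 1).2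
            simp only [Set.indicator, Set.mem_ofPred_eq, hω, if_false, Real.norm_eq_abs, add_zero]
            split_ifs
            · simpa using (half_pos hδ).le
            · exact h1.le
      _ = δ / 2 + 2 * K * (X.P (x, i)).real {ω | (ω 1).1 < M} := by
          rw [integral_add (integrable_const _) ((integrable_const _).indicator hms),
            integral_indicator hms]
          simp [mul_comm]
      _ < δ := by linarith
  simpa using herr.add hmain

theorem tendsto_tabooOp_iterate (X : MChain (ℕ × S)) (s0 : S) {p : ℝ} (hp : 0 < p)
    (hB : CondB X p) {Q : S → S → ℝ}
    (hQ : ∀ i j, Tendsto (fun x : ℕ => qhat X x i j) atTop (𝓝 (Q i j)))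
    {φ : ℕ × S → ℝ} {K : ℝ} (hφ : ∀ w, |φ w| ≤ K) {γ : S → ℝ}
    (hγ : ∀ j, Tendsto (fun x : ℕ => φ (x, j)) atTop (𝓝 (γ j))) (k : ℕ) (i : S) :
    Tendsto (fun x : ℕ => (tabooOp X s0)^[k] φ (x, i)) atTop
      (𝓝 ((tabooMat Q s0)^[k] γ i)) := by
  induction k generalizing i with
  | zero => exact hγ i
  | succ k ih =>
    simp only [Function.iterate_succ_apply']
    exact tendsto_tabooOp X s0 hp hB hQ (abs_tabooOp_iterate_le X s0 hφ k) ih i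

end Taboo

section TabooMatrix

theorem monotone_tabooMat {Q : S → S → ℝ} (hQ : ∀ i j, 0 ≤ Q i j) (s0 : S) :
    Monotone (tabooMat Q s0) := by
  intro γ γ' h i
  refine Finset.sum_le_sum fun j _ => ?_
  split_ifs
  · exact le_rfl
  · exact mul_le_mul_of_nonneg_left (h j) (hQ i j)

theorem sum_mul_tabooMat {Q : S → S → ℝ} {pst : S → ℝ} (hpst : IsStationaryDist Q pst) (s0 : S)
    (γ : S → ℝ) : ∑ i, pst i * tabooMat Q s0 γ i = (∑ i, pst i * γ i) - pst s0 * γ s0 := by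
  have h1 : ∑ i, pst i * tabooMat Q s0 γ i = ∑ j, if j = s0 then 0 else pst j * γ j := by
    simp only [tabooMat, Finset.mul_sum]
    rw [Finset.sum_comm]
    refine Finset.sum_congr rfl fun j _ => ?_
    split_ifs
    · simp
    · rw [← hpst.2.2 j, Finset.sum_mul]
      exact Finset.sum_congr rfl fun i _ => by ring
  have h2 : ∑ j, pst j * γ j
      = (∑ j, if j = s0 then 0 else pst j * γ j) + ∑ j, if j = s0 then pst j * γ j else 0 := by
    rw [← Finset.sum_add_distrib]
    exact Finset.sum_congr rfl fun j _ => by split_ifs <;> simp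
  rw [h1, h2]
  simp

theorem tendsto_tabooMat {Q : S → S → ℝ} {s0 : S} {g : ℕ → S → ℝ} {h : S → ℝ}
    (hg : ∀ i, Tendsto (fun k => g k i) atTop (𝓝 (h i))) (i : S) :
    Tendsto (fun k => tabooMat Q s0 (g k) i) atTop (𝓝 (tabooMat Q s0 h i)) := by
  refine tendsto_finsetSum _ fun j _ => ?_
  split_ifs
  · exact tendsto_const_nhds
  · exact (hg j).const_mul _

theorem tendsto_tabooMat_iterate_one {Q : S → S → ℝ} {pst : S → ℝ}
    (hQ : IsStochasticMatrix Q) (hirr : IsIrreducibleMatrix Q) (hpst : IsStationaryDist Q pst)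
    (s0 i : S) : Tendsto (fun k => (tabooMat Q s0)^[k] (fun _ => 1) i) atTop (𝓝 0) := by
  have hmono := monotone_tabooMat hQ.1 s0
  have hle : tabooMat Q s0 (fun _ => 1) ≤ fun _ => 1 := by
    intro i
    refine le_trans (Finset.sum_le_sum fun j _ => ?_) (hQ.2 i).le
    split_ifs
    · exact hQ.1 i j
    · simp
  have hanti := hmono.antitone_iterate_of_map_le hle
  have hnn : ∀ k i, 0 ≤ (tabooMat Q s0)^[k] (fun _ => 1) i := by
    intro k
    induction k with
    | zero => intro i; simp
    | succ k ih =>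
      intro i
      rw [Function.iterate_succ_apply']
      refine Finset.sum_nonneg fun j _ => ?_
      split_ifs
      · exact le_rfl
      · exact mul_nonneg (hQ.1 i j) (ih j)
  obtain ⟨h, hlim⟩ : ∃ h : S → ℝ, ∀ i,
      Tendsto (fun k => (tabooMat Q s0)^[k] (fun _ => 1) i) atTop (𝓝 (h i)) :=
    ⟨_, fun i => tendsto_atTop_ciInf (fun k l hkl => hanti hkl i)
      ⟨0, by rintro _ ⟨k, rfl⟩; exact hnn k i⟩⟩
  have h0 : ∀ i, 0 ≤ h i := fun i =>
    ge_of_tendsto (hlim i) (Eventually.of_forall fun k => hnn k i)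
  have hfix : ∀ i, tabooMat Q s0 h i = h i := by
    intro i
    refine tendsto_nhds_unique (tendsto_tabooMat hlim i) ?_
    have := (hlim i).comp (tendsto_add_atTop_nat 1)
    refine this.congr fun k => ?_
    simp only [Function.comp_apply, Function.iterate_succ_apply']
  have hs0 : h s0 = 0 := by
    have h1 := sum_mul_tabooMat hpst s0 h
    simp only [hfix] at h1
    have h2 : pst s0 * h s0 = 0 := by linarith
    exact (mul_eq_zero.1 h2).resolve_left (hpst.1 s0).ne'
  have hharm : (Matrix.of Q).mulVec h = h := by
    funext i
    rw [← hfix i]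
    refine Finset.sum_congr rfl fun j _ => ?_
    split_ifs with hj
    · simp [hj, hs0]
    · rfl
  have hharm_pow : ∀ n : ℕ, ((Matrix.of Q) ^ n).mulVec h = h := by
    intro n
    induction n with
    | zero => simp
    | succ n ih => rw [pow_succ, ← Matrix.mulVec_mulVec, hharm, ih]
  have hpow_nn : ∀ (n : ℕ) (i j : S), 0 ≤ ((Matrix.of Q) ^ n) i j := by
    intro n
    induction n with
    | zero =>
      intro i j
      rw [pow_zero, Matrix.one_apply]
      split_ifs <;> norm_num
    | succ n ih =>
      intro i j
      rw [pow_succ, Matrix.mul_apply]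
      exact Finset.sum_nonneg fun l _ => mul_nonneg (ih i l) (hQ.1 l j)
  have hz : h i = 0 := by
    obtain ⟨n, hn⟩ := hirr s0 i
    have h1 : ∑ j, ((Matrix.of Q) ^ n) s0 j * h j = 0 := by
      have := congrFun (hharm_pow n) s0
      rwa [hs0] at this
    have h2 := (Finset.sum_eq_zero_iff_of_nonneg
      fun j _ => mul_nonneg (hpow_nn n s0 j) (h0 j)).1 h1 i (Finset.mem_univ i)
    exact (mul_eq_zero.1 h2).resolve_left hn.ne'
  rw [← hz]
  exact hlim i

end TabooMatrix

section Decay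

theorem exists_measureReal_avoidSet_lt_one (X : MChain (ℕ × S)) (hirr : X.Irreducible) (s0 : S)
    (z : ℕ × S) : ∃ n, (X.P z).real (avoidSet s0 n) < 1 := by
  obtain ⟨n, hn⟩ := hirr z (z.1 + 1, s0)
  refine ⟨n, ?_⟩
  have hn1 : 1 ≤ n := by
    rcases Nat.eq_zero_or_pos n with rfl | h
    · refine absurd ?_ hn
      refine measure_mono_null (fun ω hω => ?_) (ae_iff.1 (X.ae_init z))
      have h0 : ω 0 = (z.1 + 1, s0) := hω
      intro hz
      have := congrArg Prod.fst (h0.symm.trans hz)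
      simp at this
    · exact h
  have hsub : avoidSet s0 n ⊆ {ω | ω n = (z.1 + 1, s0)}ᶜ := by
    intro ω hω h
    have h' : ω n = (z.1 + 1, s0) := h
    exact hω n hn1 le_rfl (by rw [h'])
  refine (measureReal_mono hsub).trans_lt ?_
  rw [probReal_compl_eq_one_sub (MChain.measurableSet_coord_eq n _)]
  have : 0 < (X.P z).real {ω | ω n = (z.1 + 1, s0)} := ENNReal.toReal_pos hn (measure_ne_top _ _)
  linarith

theorem exists_geometric_bound {N : ℕ} {ρ : ℝ} (hρ0 : 0 < ρ) (hρ1 : ρ < 1) :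
    ∃ A r : ℝ, 0 < A ∧ 0 < r ∧ r < 1 ∧ ∀ a : ℕ → ℝ, (∀ k, a k ≤ 1) →
      (∀ k, a (k + (N + 1)) ≤ ρ * a k) → ∀ k, a k ≤ A * r ^ k := by
  set r : ℝ := ρ ^ (((N + 1 : ℕ) : ℝ)⁻¹) with hr
  have hr0 : 0 < r := Real.rpow_pos_of_pos hρ0 _
  have hr1 : r < 1 := Real.rpow_lt_one hρ0.le hρ1 (by positivity)
  have hrN : r ^ (N + 1) = ρ := Real.rpow_inv_natCast_pow hρ0.le (Nat.succ_ne_zero N)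
  refine ⟨ρ⁻¹, r, inv_pos.2 hρ0, hr0, hr1, fun a ha1 ha k => ?_⟩
  induction k using Nat.strong_induction_on with
  | _ k ih =>
    rcases lt_or_ge k (N + 1) with hk | hk
    · refine (ha1 k).trans ?_
      rw [← hrN, inv_mul_eq_div, one_le_div (by positivity)]
      exact pow_le_pow_of_le_one hr0.le hr1.le hk.le
    · obtain ⟨l, rfl⟩ := Nat.exists_eq_add_of_le' hk
      calc a (l + (N + 1)) ≤ ρ * a l := ha l
        _ ≤ ρ * (ρ⁻¹ * r ^ l) := mul_le_mul_of_nonneg_left (ih l (by omega)) hρ0.le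
        _ = ρ⁻¹ * r ^ (l + (N + 1)) := by rw [pow_add, hrN]; ring

theorem exists_uniform_avoidSet_bound (X : MChain (ℕ × S)) (hirr : X.Irreducible) (s0 : S)
    {p : ℝ} (hp : 0 < p) (hB : CondB X p) {Q : S → S → ℝ} {pst : S → ℝ} (hQ : CondQ X Q)
    (hpst : IsStationaryDist Q pst) :
    ∃ (N : ℕ) (ρ : ℝ), 0 < ρ ∧ ρ < 1 ∧ ∀ z, (X.P z).real (avoidSet s0 N) ≤ ρ := by
  have hanti : ∀ z, Antitone fun n => (X.P z).real (avoidSet s0 n) := fun z k l hkl =>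
    measureReal_mono (avoidSet_antitone s0 hkl)
  obtain ⟨N₁, hN₁⟩ : ∃ N, ∀ i, (tabooMat Q s0)^[N] (fun _ => 1) i < 1 / 2 :=
    (eventually_all.2 fun i => (tendsto_tabooMat_iterate_one hQ.2.1 hQ.2.2 hpst s0 i
      ).eventually_lt_const one_half_pos).exists
  have hlarge : ∀ᶠ x : ℕ in atTop, ∀ i, (X.P (x, i)).real (avoidSet s0 N₁) < 1 / 2 := by
    refine eventually_all.2 fun i => ?_
    have := tendsto_tabooOp_iterate X s0 hp hB hQ.1 (φ := fun _ => 1) (K := 1) (by simp)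
      (γ := fun _ => 1) (fun _ => tendsto_const_nhds) N₁ i
    simp only [← measureReal_avoidSet] at this
    exact this.eventually_lt_const (hN₁ i)
  obtain ⟨x₀, hx₀⟩ := eventually_atTop.1 hlarge
  choose n hn using exists_measureReal_avoidSet_lt_one X hirr s0
  set F : Finset (ℕ × S) := Finset.range x₀ ×ˢ Finset.univ with hF
  set N := max N₁ (F.sup n) with hN
  have hmem : ∀ z : ℕ × S, z ∉ F → (X.P z).real (avoidSet s0 N) ≤ 1 / 2 := by
    intro z hz
    have hz' : x₀ ≤ z.1 := by simpa [hF] using hz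
    exact (hanti z (le_max_left _ _)).trans (hx₀ z.1 hz' z.2).le
  have hsmall : ∀ z ∈ F, (X.P z).real (avoidSet s0 N) < 1 := fun z hz =>
    (hanti z ((Finset.le_sup hz).trans (le_max_right _ _))).trans_lt (hn z)
  obtain ⟨ρ, hρ1, hρ⟩ : ∃ ρ : ℝ, ρ < 1 ∧ ∀ z ∈ F, (X.P z).real (avoidSet s0 N) ≤ ρ := by
    rcases F.eq_empty_or_nonempty with h | h
    · exact ⟨0, one_pos, by simp [h]⟩
    · obtain ⟨w, hw, hmax⟩ := F.exists_max_image (fun z => (X.P z).real (avoidSet s0 N)) h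
      exact ⟨_, hsmall w hw, hmax⟩
  refine ⟨N, max (1 / 2) ρ, lt_max_of_lt_left one_half_pos, max_lt one_half_lt_one hρ1,
    fun z => ?_⟩
  by_cases hz : z ∈ F
  · exact (hρ z hz).trans (le_max_right _ _)
  · exact (hmem z hz).trans (le_max_left _ _)

theorem exists_geometric_avoidSet_bound (X : MChain (ℕ × S)) (hirr : X.Irreducible) (s0 : S)
    {p : ℝ} (hp : 0 < p) (hB : CondB X p) {Q : S → S → ℝ} {pst : S → ℝ} (hQ : CondQ X Q)
    (hpst : IsStationaryDist Q pst) :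
    ∃ A r : ℝ, 0 < A ∧ 0 < r ∧ r < 1 ∧
      ∀ z k, (X.P z).real (avoidSet s0 k) ≤ A * r ^ k := by
  obtain ⟨N, ρ, hρ0, hρ1, hρ⟩ := exists_uniform_avoidSet_bound X hirr s0 hp hB hQ hpst
  obtain ⟨A, r, hA, hr0, hr1, h⟩ := exists_geometric_bound (N := N) hρ0 hρ1
  refine ⟨A, r, hA, hr0, hr1, fun z => h _ (fun k => measureReal_le_one) fun k => ?_⟩
  have hρ' : ∀ w, (X.P w).real (avoidSet s0 (N + 1)) ≤ ρ := fun w =>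
    (measureReal_mono (avoidSet_antitone s0 N.le_succ)).trans (hρ w)
  have hb : ∀ w, |(X.P w).real (avoidSet s0 (N + 1))| ≤ ρ := fun w => by
    rw [abs_of_nonneg measureReal_nonneg]
    exact hρ' w
  have heq : (X.P z).real (avoidSet s0 (k + (N + 1)))
      = ∫ ω in avoidSet s0 k, (X.P (ω k)).real (avoidSet s0 (N + 1)) ∂(X.P z) := by
    rw [setIntegral_avoidSet X s0 (φ := fun w => (X.P w).real (avoidSet s0 (N + 1))) hb,
      measureReal_avoidSet, Function.iterate_add_apply]
    simp only [measureReal_avoidSet]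
  calc _ = ∫ ω in avoidSet s0 k, (X.P (ω k)).real (avoidSet s0 (N + 1)) ∂(X.P z) := heq
    _ ≤ ∫ ω in avoidSet s0 k, ρ ∂(X.P z) :=
      integral_mono (integrable_of_coord X z hb k).integrableOn (integrable_const _)
        fun ω => hρ' (ω k)
    _ = ρ * (X.P z).real (avoidSet s0 k) := by simp [mul_comm]

end Decay

section Excursion

/-- The increment of the `ℕ`-coordinate at time `k`, if the `S`-coordinate has not returned to
`s0` by then, and `0` otherwise. -/
noncomputable def avoidJump (s0 : S) (k : ℕ) : (ℕ → ℕ × S) → ℝ :=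
  (avoidSet s0 k).indicator fun ω => ((ω (k + 1)).1 : ℝ) - (ω k).1

theorem measurable_jump (k : ℕ) :
    Measurable fun ω : ℕ → ℕ × S => ((ω (k + 1)).1 : ℝ) - (ω k).1 :=
  (measurable_of_coord (fun w => (w.1 : ℝ)) (k + 1)).sub
    (measurable_of_coord (fun w => (w.1 : ℝ)) k)

theorem measurable_avoidJump (s0 : S) (k : ℕ) : Measurable (avoidJump s0 k) :=
  (measurable_jump k).indicator (measurableSet_avoidSet s0 k)

theorem Real.enorm_rpow_eq_ofReal {p : ℝ} (hp : 0 ≤ p) (a : ℝ) :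
    ‖a‖ₑ ^ p = ENNReal.ofReal (|a| ^ p) := by
  rw [Real.enorm_eq_ofReal_abs, ENNReal.ofReal_rpow_of_nonneg (abs_nonneg a) hp]

theorem eLpNorm_avoidJump_le (X : MChain (ℕ × S)) (s0 : S) {p : ℝ} (hp : 0 < p) {C : ℝ≥0∞}
    (hC : ∀ (x : ℕ) (i : S),
      (∫⁻ ω, ENNReal.ofReal (|((ω 1).1 : ℝ) - (x : ℝ)| ^ p) ∂(X.P (x, i))) ≤ C)
    (k : ℕ) (z : ℕ × S) :
    eLpNorm (avoidJump s0 k) (ENNReal.ofReal p) (X.P z)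
      ≤ (C * X.P z (avoidSet s0 k)) ^ (1 / p) := by
  have hp0 : ENNReal.ofReal p ≠ 0 := by simpa using hp
  rw [avoidJump, eLpNorm_indicator_eq_eLpNorm_restrict (measurableSet_avoidSet s0 k),
    eLpNorm_eq_lintegral_rpow_enorm_toReal hp0 ENNReal.ofReal_ne_top, ENNReal.toReal_ofReal hp.le]
  refine ENNReal.rpow_le_rpow ?_ (by positivity)
  have hstep : ∀ w : ℕ × S,
      ∫⁻ ω, ‖((ω 1).1 : ℝ) - (ω 0).1‖ₑ ^ p ∂(X.P w) ≤ C := by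
    intro w
    refine le_trans (le_of_eq (lintegral_congr_ae ?_)) (hC w.1 w.2)
    filter_upwards [X.ae_init w] with ω hω
    rw [hω, Real.enorm_rpow_eq_ofReal hp.le]
  have hG : Measurable fun ω : ℕ → ℕ × S => ‖((ω 1).1 : ℝ) - (ω 0).1‖ₑ ^ p :=
    (measurable_jump 0).enorm.pow_const p
  calc ∫⁻ ω in avoidSet s0 k, ‖((ω (k + 1)).1 : ℝ) - (ω k).1‖ₑ ^ p ∂(X.P z)
      = ∫⁻ ω in avoidSet s0 k,
          (∫⁻ ω', ‖((ω' 1).1 : ℝ) - (ω' 0).1‖ₑ ^ p ∂(X.P (ω k))) ∂(X.P z) :=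
        X.lintegral_shift z k (dependsUpTo_avoidSet s0 k) hG
    _ ≤ ∫⁻ ω in avoidSet s0 k, C ∂(X.P z) := lintegral_mono fun ω => hstep (ω k)
    _ = C * X.P z (avoidSet s0 k) := by simp

theorem exists_eLpNorm_avoidJump_bound (X : MChain (ℕ × S)) (hirr : X.Irreducible) (s0 : S)
    {p : ℝ} (hp : 0 < p) (hB : CondB X p) {Q : S → S → ℝ} {pst : S → ℝ} (hQ : CondQ X Q)
    (hpst : IsStationaryDist Q pst) :
    ∃ D s : ℝ, 0 ≤ D ∧ 0 ≤ s ∧ s < 1 ∧ ∀ k z,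
      eLpNorm (avoidJump s0 k) (ENNReal.ofReal p) (X.P z) ≤ ENNReal.ofReal (D * s ^ k) := by
  obtain ⟨A, r, hA, hr0, hr1, hAr⟩ := exists_geometric_avoidSet_bound X hirr s0 hp hB hQ hpst
  obtain ⟨C, hCtop, hC⟩ := hB
  lift C to ℝ≥0 using hCtop
  refine ⟨(C * A) ^ (1 / p), r ^ (1 / p), by positivity, by positivity,
    Real.rpow_lt_one hr0.le hr1 (by positivity), fun k z => ?_⟩
  refine (eLpNorm_avoidJump_le X s0 hp hC k z).trans ?_
  have h1 : X.P z (avoidSet s0 k) ≤ ENNReal.ofReal (A * r ^ k) := by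
    rw [← ofReal_measureReal]
    exact ENNReal.ofReal_le_ofReal (hAr z k)
  have h2 : (C * A) ^ (1 / p) * (r ^ (1 / p)) ^ k = ((C : ℝ) * (A * r ^ k)) ^ (1 / p) := by
    rw [← mul_assoc, Real.mul_rpow (x := (C : ℝ) * A) (by positivity) (by positivity),
      ← Real.rpow_natCast, ← Real.rpow_natCast, ← Real.rpow_mul hr0.le, ← Real.rpow_mul hr0.le, mul_comm (1 / p)]
  rw [h2, ← ENNReal.ofReal_rpow_of_nonneg (by positivity) (by positivity),
    ENNReal.ofReal_mul C.coe_nonneg, ENNReal.ofReal_coe_nnreal]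
  gcongr

theorem hasSum_avoidJump {s0 : S} {ω : ℕ → ℕ × S} {k : ℕ} (hk : ω ∉ avoidSet s0 k) :
    HasSum (fun n => avoidJump s0 n ω) (((ω (tauRet s0 ω)).1 : ℝ) - (ω 0).1) := by
  have hne : {n | 1 ≤ n ∧ (ω n).2 = s0}.Nonempty := by
    by_contra h
    refine hk fun m h1 _ hm => h ⟨m, h1, hm⟩
  have hτ : 1 ≤ tauRet s0 ω ∧ (ω (tauRet s0 ω)).2 = s0 := Nat.sInf_mem hne
  have hmem : ∀ n, ω ∈ avoidSet s0 n ↔ n < tauRet s0 ω := by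
    intro n
    constructor
    · intro h
      by_contra hn
      exact h _ hτ.1 (not_lt.1 hn) hτ.2
    · intro hn m h1 hm hs
      have : tauRet s0 ω ≤ m := Nat.sInf_le ⟨h1, hs⟩
      omega
  rw [← Finset.sum_range_sub (fun n => ((ω n).1 : ℝ)) (tauRet s0 ω)]
  have hsum : ∑ n ∈ Finset.range (tauRet s0 ω), (((ω (n + 1)).1 : ℝ) - (ω n).1)
      = ∑ n ∈ Finset.range (tauRet s0 ω), avoidJump s0 n ω := by
    refine Finset.sum_congr rfl fun n hn => ?_
    rw [avoidJump, Set.indicator_of_mem ((hmem n).2 (Finset.mem_range.1 hn))]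
  rw [hsum]
  refine hasSum_sum_of_ne_finset_zero fun n hn => ?_
  rw [avoidJump, Set.indicator_of_notMem fun h => hn (Finset.mem_range.2 ((hmem n).1 h))]

theorem ae_hasSum_avoidJump (X : MChain (ℕ × S)) (hirr : X.Irreducible) (s0 : S)
    {p : ℝ} (hp : 0 < p) (hB : CondB X p) {Q : S → S → ℝ} {pst : S → ℝ} (hQ : CondQ X Q)
    (hpst : IsStationaryDist Q pst) (z : ℕ × S) :
    ∀ᵐ ω ∂(X.P z),
      HasSum (fun n => avoidJump s0 n ω) (((ω (tauRet s0 ω)).1 : ℝ) - (z.1 : ℝ)) := by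
  obtain ⟨A, r, hA, hr0, hr1, hAr⟩ := exists_geometric_avoidSet_bound X hirr s0 hp hB hQ hpst
  have hnull : X.P z (⋂ k, avoidSet s0 k) = 0 := by
    have hlim : Tendsto (fun k : ℕ => A * r ^ k) atTop (𝓝 0) := by
      simpa using (tendsto_pow_atTop_nhds_zero_of_lt_one hr0.le hr1).const_mul A
    have hle : (X.P z).real (⋂ k, avoidSet s0 k) ≤ 0 :=
      ge_of_tendsto' hlim fun k => (measureReal_mono (Set.iInter_subset _ k)).trans (hAr z k)
    exact (measureReal_eq_zero_iff).1 (le_antisymm hle measureReal_nonneg)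
  filter_upwards [X.ae_init z, measure_eq_zero_iff_ae_notMem.1 hnull] with ω h0 hω
  obtain ⟨k, hk⟩ := not_forall.1 fun h => hω (Set.mem_iInter.2 h)
  rw [← h0]
  exact hasSum_avoidJump hk

theorem integral_norm_avoidJump_le (X : MChain (ℕ × S)) (s0 : S) {p : ℝ} (hp : 1 ≤ p) {b : ℝ}
    (hb : 0 ≤ b) (k : ℕ) (z : ℕ × S)
    (h : eLpNorm (avoidJump s0 k) (ENNReal.ofReal p) (X.P z) ≤ ENNReal.ofReal b) :
    Integrable (avoidJump s0 k) (X.P z) ∧ ∫ ω, ‖avoidJump s0 k ω‖ ∂(X.P z) ≤ b := by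
  have hm := (measurable_avoidJump s0 k).aestronglyMeasurable (μ := X.P z)
  have h1 : ∫⁻ ω, ‖avoidJump s0 k ω‖ₑ ∂(X.P z) ≤ ENNReal.ofReal b := by
    rw [← eLpNorm_one_eq_lintegral_enorm]
    exact (eLpNorm_le_eLpNorm_of_exponent_le (by simpa using hp) hm).trans h
  refine ⟨⟨hm, h1.trans_lt ENNReal.ofReal_lt_top⟩, ?_⟩
  rw [integral_norm_eq_lintegral_enorm hm]
  exact ENNReal.toReal_le_of_le_ofReal hb h1

theorem abs_stepMoment_one_le (X : MChain (ℕ × S)) (s0 : S) {b : ℝ} (z : ℕ × S)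
    (h : ∫ ω, ‖avoidJump s0 0 ω‖ ∂(X.P z) ≤ b) : |stepMoment X 1 z.1 z.2| ≤ b := by
  have heq : stepMoment X 1 z.1 z.2 = ∫ ω, avoidJump s0 0 ω ∂(X.P z) := by
    refine integral_congr_ae ?_
    filter_upwards [X.ae_init z] with ω hω
    simp [avoidJump, avoidSet_zero, hω]
  rw [heq]
  exact (norm_integral_le_integral_norm _).trans h

theorem integral_avoidJump (X : MChain (ℕ × S)) (s0 : S) {K : ℝ}
    (hK : ∀ w : ℕ × S, |stepMoment X 1 w.1 w.2| ≤ K) (k : ℕ) (z : ℕ × S)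
    (hi : Integrable (avoidJump s0 k) (X.P z)) :
    ∫ ω, avoidJump s0 k ω ∂(X.P z)
      = (tabooOp X s0)^[k] (fun w => stepMoment X 1 w.1 w.2) z := by
  have hstep : ∀ w : ℕ × S,
      ∫ ω, (((ω 1).1 : ℝ) - (ω 0).1) ∂(X.P w) = stepMoment X 1 w.1 w.2 := by
    intro w
    refine integral_congr_ae ?_
    filter_upwards [X.ae_init w] with ω hω
    simp [hω]
  rw [← setIntegral_avoidSet X s0 hK, avoidJump,
    integral_indicator (measurableSet_avoidSet s0 k)]
  have hi1 := (integrable_indicator_iff (measurableSet_avoidSet s0 k)).1 hi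
  have hi2 : IntegrableOn (fun ω : ℕ → ℕ × S => stepMoment X 1 (ω k).1 (ω k).2)
      (avoidSet s0 k) (X.P z) := (integrable_of_coord X z hK k).integrableOn
  have h := X.integral_shift z k (dependsUpTo_avoidSet s0 k)
    (G := fun ω => ((ω 1).1 : ℝ) - (ω 0).1) (measurable_jump 0) hi1
    (by simpa only [hstep] using hi2)
  simpa only [hstep, add_zero] using h

theorem eLpNorm_return_le (X : MChain (ℕ × S)) (s0 : S) {p : ℝ} (hp : 1 ≤ p) {D s : ℝ}
    (hD : 0 ≤ D) (hs0 : 0 ≤ s) (hs1 : s < 1) (z : ℕ × S)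
    (hbd : ∀ k, eLpNorm (avoidJump s0 k) (ENNReal.ofReal p) (X.P z)
      ≤ ENNReal.ofReal (D * s ^ k))
    (hsum : ∀ᵐ ω ∂(X.P z),
      HasSum (fun n => avoidJump s0 n ω) (((ω (tauRet s0 ω)).1 : ℝ) - (z.1 : ℝ))) :
    eLpNorm (fun ω => ((ω (tauRet s0 ω)).1 : ℝ) - (z.1 : ℝ)) (ENNReal.ofReal p) (X.P z)
      ≤ ENNReal.ofReal (D * (1 - s)⁻¹) := by
  have hm : ∀ k, AEStronglyMeasurable (avoidJump s0 k) (X.P z) := fun k =>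
    (measurable_avoidJump s0 k).aestronglyMeasurable
  have hpart : ∀ n, eLpNorm (∑ k ∈ Finset.range n, avoidJump s0 k) (ENNReal.ofReal p) (X.P z)
      ≤ ENNReal.ofReal (D * (1 - s)⁻¹) := by
    intro n
    refine (eLpNorm_sum_le (fun k _ => hm k) (by simpa using hp)).trans ?_
    refine (Finset.sum_le_sum fun k _ => hbd k).trans ?_
    rw [← ENNReal.ofReal_sum_of_nonneg fun k _ => by positivity]
    refine ENNReal.ofReal_le_ofReal ?_
    rw [← tsum_geometric_of_lt_one hs0 hs1, ← Finset.mul_sum]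
    exact mul_le_mul_of_nonneg_left ((summable_geometric_of_lt_one hs0 hs1).sum_le_tsum _
      fun k _ => by positivity) hD
  refine (Lp.eLpNorm_lim_le_liminf_eLpNorm (f := fun n => ∑ k ∈ Finset.range n, avoidJump s0 k)
    (fun n => Finset.aestronglyMeasurable_sum _ fun k _ => hm k) _ ?_).trans ?_
  · filter_upwards [hsum] with ω hω
    simpa only [Finset.sum_apply] using hω.tendsto_sum_nat
  · exact liminf_le_of_le (by isBoundedDefault) fun b hb => by
      obtain ⟨n, hn⟩ := hb.exists
      exact hn.trans (hpart n)

theorem tsum_tabooMat_iterate {Q : S → S → ℝ} {pst : S → ℝ} (hpst : IsStationaryDist Q pst)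
    (s0 : S) (d : S → ℝ) (hsum : ∀ i, Summable fun k => (tabooMat Q s0)^[k] d i) :
    ∑' k, (tabooMat Q s0)^[k] d s0 = (∑ i, d i * pst i) / pst s0 := by
  set g : S → ℝ := fun i => ∑' k, (tabooMat Q s0)^[k] d i with hg
  have hrec : ∀ i, g i = d i + tabooMat Q s0 g i := by
    intro i
    have h1 : tabooMat Q s0 g i = ∑' k, (tabooMat Q s0)^[k + 1] d i := by
      refine (HasSum.tsum_eq ?_).symm
      simp only [Function.iterate_succ_apply']
      refine hasSum_sum fun j _ => ?_
      split_ifs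
      · exact hasSum_zero
      · exact (hsum j).hasSum.mul_left _
    rw [h1, hg]
    exact (hsum i).tsum_eq_zero_add
  have h2 := sum_mul_tabooMat hpst s0 g
  have h3 : ∑ i, pst i * g i = ∑ i, d i * pst i + ∑ i, pst i * tabooMat Q s0 g i := by
    rw [← Finset.sum_add_distrib]
    exact Finset.sum_congr rfl fun i _ => by rw [hrec i]; ring
  rw [eq_div_iff (hpst.1 s0).ne', mul_comm]
  have : pst s0 * g s0 = ∑ i, d i * pst i := by linarith
  exact this

end Excursion

/-- Lemma (embedded increments, constant-drift case): under (B_p) for some `p > 1`, (Q_∞) and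
(M_C), the embedded increments `Y_1 − Y_0 = X_τ − X_0` (under `P_{x,s0}`) have uniformly
bounded `(1+ε)`-moments, and mean `(Σ_i d_i π(i))/π(s0) + o(1)` as `x → ∞`. -/
theorem stmt13 (X : MChain (ℕ × S)) (hirr : X.Irreducible) (s0 : S)
    (p : ℝ) (hp : 1 < p) (hB : CondB X p)
    (Q : S → S → ℝ) (pst : S → ℝ) (hQ : CondQ X Q) (hpst : IsStationaryDist Q pst)
    (d : S → ℝ) (hd : CondMC X d) :
    (∃ ε : ℝ, 0 < ε ∧ ∃ C : ℝ≥0∞, C ≠ ⊤ ∧ ∀ x : ℕ,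
      (∫⁻ ω, ENNReal.ofReal (|((ω (tauRet s0 ω)).1 : ℝ) - (x : ℝ)| ^ (1 + ε))
        ∂(X.P (x, s0))) ≤ C) ∧
    Tendsto (fun x : ℕ => ∫ ω, (((ω (tauRet s0 ω)).1 : ℝ) - (x : ℝ)) ∂(X.P (x, s0)))
      atTop (nhds ((∑ i, d i * pst i) / pst s0)) := by
  have hp0 : 0 < p := one_pos.trans hp
  obtain ⟨D, s, hD, hs0, hs1, hbd⟩ := exists_eLpNorm_avoidJump_bound X hirr s0 hp0 hB hQ hpst
  have hsum := ae_hasSum_avoidJump X hirr s0 hp0 hB hQ hpst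
  have hbd' := fun k z => integral_norm_avoidJump_le X s0 hp.le
    (mul_nonneg hD (pow_nonneg hs0 k)) k z (hbd k z)
  constructor
  · refine ⟨p - 1, by linarith, ENNReal.ofReal (D * (1 - s)⁻¹) ^ p,
      ENNReal.rpow_ne_top_of_nonneg hp0.le ENNReal.ofReal_ne_top, fun x => ?_⟩
    have h := eLpNorm_return_le X s0 hp.le hD hs0 hs1 (x, s0) (fun k => hbd k _) (hsum _)
    rw [eLpNorm_eq_lintegral_rpow_enorm_toReal (by simpa using hp0) ENNReal.ofReal_ne_top,
      ENNReal.toReal_ofReal hp0.le, one_div, ENNReal.rpow_inv_le_iff hp0] at h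
    simpa only [add_sub_cancel, ← Real.enorm_rpow_eq_ofReal hp0.le] using h
  · have hK : ∀ w : ℕ × S, |stepMoment X 1 w.1 w.2| ≤ D * s ^ 0 := fun w =>
      abs_stepMoment_one_le X s0 w (hbd' 0 w).2
    have hgeom : Summable fun k => D * s ^ k := (summable_geometric_of_lt_one hs0 hs1).mul_left D
    have hmean : ∀ z : ℕ × S, ∫ ω, (((ω (tauRet s0 ω)).1 : ℝ) - (z.1 : ℝ)) ∂(X.P z)
        = ∑' k, (tabooOp X s0)^[k] (fun w => stepMoment X 1 w.1 w.2) z := by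
      intro z
      have h1 := hasSum_integral_of_summable_integral_norm (μ := X.P z)
        (F := fun k => avoidJump s0 k) (fun k => (hbd' k z).1)
        (hgeom.of_nonneg_of_le (fun k => integral_nonneg fun _ => norm_nonneg _)
          fun k => (hbd' k z).2)
      simp only [fun k => integral_avoidJump X s0 hK k z (hbd' k z).1] at h1
      rw [h1.tsum_eq]
      refine integral_congr_ae ?_
      filter_upwards [hsum z] with ω hω
      exact hω.tsum_eq.symm
    have hle : ∀ k z, |(tabooOp X s0)^[k] (fun w => stepMoment X 1 w.1 w.2) z| ≤ D * s ^ k := by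
      intro k z
      rw [← integral_avoidJump X s0 hK k z (hbd' k z).1]
      exact (norm_integral_le_integral_norm _).trans (hbd' k z).2
    have hlim : ∀ k i, Tendsto
        (fun x : ℕ => (tabooOp X s0)^[k] (fun w => stepMoment X 1 w.1 w.2) (x, i)) atTop
        (𝓝 ((tabooMat Q s0)^[k] d i)) :=
      tendsto_tabooOp_iterate X s0 hp0 hB hQ.1 hK hd
    have hsummable : ∀ i, Summable fun k => (tabooMat Q s0)^[k] d i := fun i =>
      hgeom.of_norm_bounded fun k =>
        le_of_tendsto (hlim k i).abs (Eventually.of_forall fun x => hle k (x, i))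
    rw [← tsum_tabooMat_iterate hpst s0 d hsummable]
    refine (tendsto_tsum_of_dominated_convergence hgeom (fun k => hlim k s0)
      (Eventually.of_forall fun x k => hle k (x, s0))).congr fun x => ?_
    exact (hmean (x, s0)).symm
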